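/- Let $\mathcal{L} \subset \mathbb{R}^n$ be a lattice, $\epsilon \in (0,1/3)$, $s \ge \sqrt{2}\,\eta_\epsilon(\mathcal{L})$, and $\vec{t}_1, \vec{t}_2 \in \mathbb{R}^n$. Let $\vec{X}_1 \sim D_{\mathcal{L}+\vec{t}_1,s}$ and $\vec{X}_2 \sim D_{\mathcal{L}+\vec{t}_2,s}$ be independent. Then for every $\vec{y} \in \mathcal{L}+\vec{t}_1+\vec{t}_2$, $\Pr[\vec{X}_1+\vec{X}_2 = \vec{y}] = e^{\pm 6\epsilon} \cdot \rho_{\sqrt{2}s}(\vec{y})/\rho_{\sqrt{2}s}(\mathcal{L}+\vec{t}_1+\vec{t}_2)$, i.e., the distribution of $\vec{X}_1+\vec{X}_2$ is pointwise within a multiplicative factor $e^{6\epsilon}$ of $D_{\mathcal{L}+\vec{t}_1+\vec{t}_2,\sqrt{2}s}$. -/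

import Mathlib

open scoped BigOperators RealInnerProductSpace

noncomputable section

abbrev Euc (n : ℕ) := EuclideanSpace ℝ (Fin n)

def gaussianMass {n : ℕ} (s : ℝ) (A : Set (Euc n)) : ℝ :=
  ∑' x : A, Real.exp (-Real.pi * ‖(x : Euc n)‖ ^ 2 / s ^ 2)

def dualLattice {n : ℕ} (L : Set (Euc n)) : Set (Euc n) :=
  {x | x ∈ Submodule.span ℝ L ∧ (∀ y ∈ L, ∃ k : ℤ, ⟪x, y⟫ = (k : ℝ))}

def eta {n : ℕ} (ε : ℝ) (L : Set (Euc n)) : ℝ :=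
  sInf {s : ℝ | 0 < s ∧ gaussianMass (1 / s) (dualLattice L \ {0}) ≤ ε}

def etaBar {n : ℕ} (ε : ℝ) (L : Submodule ℤ (Euc n)) : ℝ :=
  sInf {t : ℝ | ∃ L' : Submodule ℤ (Euc n), L' ≤ L ∧ L' ≠ ⊥ ∧ t = eta ε (L' : Set (Euc n))}

def lambdaOne {n : ℕ} (L : Set (Euc n)) : ℝ :=
  sInf {r : ℝ | ∃ x ∈ L, x ≠ 0 ∧ ‖x‖ = r}

def succMin {n : ℕ} (L : Set (Euc n)) (k : ℕ) : ℝ :=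
  sInf {r : ℝ | 0 ≤ r ∧ k ≤ Module.finrank ℝ (Submodule.span ℝ {y ∈ L | ‖y‖ ≤ r})}

open MeasureTheory Set Topology

/-- The integer vector `k` viewed as a real vector. -/
def intVec {d : ℕ} (k : Fin d → ℤ) : Fin d → ℝ := fun i => (k i : ℝ)

lemma summable_pi_prod {f : ℤ → ℝ} (hf : Summable f) (h0 : 0 ≤ f) (d : ℕ) :
    Summable fun k : Fin d → ℤ => ∏ i, f (k i) := by
  induction d with
  | zero => exact .of_finite
  | succ d ih =>
    rw [← (Fin.consEquiv fun _ : Fin (d + 1) => ℤ).summable_iff]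
    have := hf.mul_of_nonneg ih h0 fun k => Finset.prod_nonneg fun i _ => h0 (k i)
    refine this.congr fun p => ?_
    simp [Fin.prod_univ_succ, Fin.consEquiv]

lemma summable_exp_neg_mul_int_sq {c : ℝ} (hc : 0 < c) :
    Summable fun k : ℤ => Real.exp (-c * (k : ℝ) ^ 2) := by
  have hnat : Summable fun k : ℕ => Real.exp (-c * (k : ℝ) ^ 2) := by
    refine Summable.of_nonneg_of_le (fun _ => (Real.exp_pos _).le) (fun k => ?_)
      (Real.summable_exp_nat_mul_iff.mpr (neg_lt_zero.mpr hc))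
    rw [Real.exp_le_exp]
    have : (k : ℝ) ≤ (k : ℝ) ^ 2 := by exact_mod_cast Nat.le_self_pow two_ne_zero k
    nlinarith
  refine Summable.of_nat_of_neg ?_ ?_ <;> simpa using hnat

/-- A Gaussian is summable over any family of vectors growing linearly in its integer index. -/
lemma summable_exp_neg_mul_norm_sq {E : Type*} [NormedAddCommGroup E] {d : ℕ}
    {w : (Fin d → ℤ) → E} {K : ℝ} (hK : 0 < K)
    (hw : ∀ k, ∑ i, (k i : ℝ) ^ 2 ≤ K * ‖w k‖ ^ 2) {c : ℝ} (hc : 0 < c) :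
    Summable fun k => Real.exp (-c * ‖w k‖ ^ 2) := by
  refine Summable.of_nonneg_of_le (fun _ => (Real.exp_pos _).le) (fun k => ?_)
    (summable_pi_prod (summable_exp_neg_mul_int_sq (div_pos hc hK))
      (fun _ => (Real.exp_pos _).le) d)
  rw [← Real.exp_sum, Real.exp_le_exp, ← Finset.mul_sum]
  have := mul_le_mul_of_nonneg_left (hw k) (div_pos hc hK).le
  have h2 : c / K * (K * ‖w k‖ ^ 2) = c * ‖w k‖ ^ 2 := by field_simp
  linarith

lemma exp_neg_mul_norm_add_sq_le {E : Type*} [NormedAddCommGroup E] {c R : ℝ} (hc : 0 ≤ c)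
    {t : E} (ht : ‖t‖ ≤ R) (v : E) :
    Real.exp (-c * ‖v + t‖ ^ 2) ≤ Real.exp (c * R ^ 2) * Real.exp (-(c / 2) * ‖v‖ ^ 2) := by
  rw [← Real.exp_add, Real.exp_le_exp]
  have h1 : ‖v‖ ≤ ‖v + t‖ + ‖t‖ := by simpa using norm_sub_le (v + t) t
  have h2 : ‖v‖ ^ 2 ≤ 2 * ‖v + t‖ ^ 2 + 2 * R ^ 2 := by
    nlinarith [norm_nonneg v, norm_nonneg t, sq_nonneg (‖v + t‖ - ‖t‖), norm_nonneg (v + t)]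
  nlinarith

/-- The half-open unit cube with lower corner `a`. -/
def unitCube {d : ℕ} (a : Fin d → ℝ) : Set (Fin d → ℝ) := {x | ∀ i, x i ∈ Ioc (a i) (a i + 1)}

lemma measurableSet_unitCube {d : ℕ} (a : Fin d → ℝ) : MeasurableSet (unitCube a) :=
  MeasurableSet.univ_pi' fun _ => measurableSet_Ioc

lemma iUnion_unitCube_intVec {d : ℕ} : ⋃ k : Fin d → ℤ, unitCube (intVec k) = univ := by
  refine eq_univ_of_forall fun x => mem_iUnion.mpr ⟨fun i => ⌈x i⌉ - 1, fun i => ?_⟩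
  have h1 := Int.ceil_lt_add_one (x i)
  have h2 := Int.le_ceil (x i)
  simp only [intVec, mem_Ioc]
  push_cast
  constructor <;> linarith

lemma pairwise_disjoint_unitCube_intVec {d : ℕ} :
    Pairwise (Function.onFun Disjoint fun k : Fin d → ℤ => unitCube (intVec k)) := by
  intro k l hkl
  refine disjoint_left.mpr fun x hx hy => hkl (funext fun i => ?_)
  have h1 := hx i
  have h2 := hy i
  simp only [intVec, mem_Ioc] at h1 h2
  have h3 : (k i : ℝ) < l i + 1 := by linarith
  have h4 : (l i : ℝ) < k i + 1 := by linarith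
  norm_cast at h3 h4
  omega

lemma setIntegral_unitCube_intVec {d : ℕ} (h : (Fin d → ℝ) → ℂ) (k : Fin d → ℤ) :
    ∫ x in unitCube (intVec k), h x = ∫ x in unitCube 0, h (x + intVec k) := by
  rw [← (measurePreserving_add_right volume (intVec k)).setIntegral_preimage_emb
    (measurableEmbedding_addRight _)]
  congr 2
  ext x
  simp only [unitCube, mem_preimage, mem_ofPred_eq, Pi.add_apply, Pi.zero_apply, mem_Ioc]
  refine forall_congr' fun i => ?_
  constructor <;> rintro ⟨h1, h2⟩ <;> constructor <;> linarith

/-- The integral over `ℝᵈ` is the integral over the unit cube of the periodization. -/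
lemma integral_unitCube_tsum {d : ℕ} {h : (Fin d → ℝ) → ℂ} (hc : Continuous h)
    (hi : Integrable h) {u : (Fin d → ℤ) → ℝ} (hu : Summable u)
    (hb : ∀ k, ∀ x ∈ unitCube (0 : Fin d → ℝ), ‖h (x + intVec k)‖ ≤ u k) :
    ∫ x in unitCube 0, ∑' k : Fin d → ℤ, h (x + intVec k) = ∫ x, h x := by
  have hfin : volume (unitCube (0 : Fin d → ℝ)) < ⊤ := by
    have : unitCube (0 : Fin d → ℝ) ⊆ Icc 0 1 := fun x hx =>
      ⟨fun i => (hx i).1.le, fun i => by simpa using (hx i).2⟩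
    exact (measure_mono this).trans_lt isCompact_Icc.measure_lt_top
  have : IsFiniteMeasure (volume.restrict (unitCube (0 : Fin d → ℝ))) :=
    ⟨by simpa using hfin⟩
  have hsum := hasSum_integral_of_dominated_convergence
    (μ := volume.restrict (unitCube (0 : Fin d → ℝ)))
    (F := fun (k : Fin d → ℤ) x => h (x + intVec k))
    (f := fun x => ∑' k : Fin d → ℤ, h (x + intVec k)) (fun k _ => u k)
    (fun k => (hc.comp (continuous_id.add continuous_const)).aestronglyMeasurable)
    (fun k => (ae_restrict_iff' (measurableSet_unitCube 0)).mpr (.of_forall (hb k)))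
    (.of_forall fun _ => hu) (integrable_const _)
    ((ae_restrict_iff' (measurableSet_unitCube 0)).mpr (.of_forall fun x hx =>
      (Summable.of_norm_bounded hu fun k => hb k x hx).hasSum))
  have hU := hasSum_integral_iUnion (μ := volume) (f := h)
    (fun k : Fin d → ℤ => measurableSet_unitCube (intVec k))
    pairwise_disjoint_unitCube_intVec hi.integrableOn
  rw [iUnion_unitCube_intVec, setIntegral_univ] at hU
  simp_rw [setIntegral_unitCube_intVec] at hU
  exact hsum.unique hU

/-- The character of `ℝᵈ` with integral frequency `m`. -/
def intChar {d : ℕ} (m : Fin d → ℤ) (x : Fin d → ℝ) : ℂ :=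
  Complex.exp (2 * Real.pi * Complex.I * ((∑ i, (m i : ℝ) * x i : ℝ) : ℂ))

lemma norm_intChar {d : ℕ} (m : Fin d → ℤ) (x : Fin d → ℝ) : ‖intChar m x‖ = 1 := by
  rw [intChar, show (2 * Real.pi * Complex.I * ((∑ i, (m i : ℝ) * x i : ℝ) : ℂ)) =
    ((2 * Real.pi * ∑ i, (m i : ℝ) * x i : ℝ) : ℂ) * Complex.I by push_cast; ring]
  exact Complex.norm_exp_ofReal_mul_I _

lemma continuous_intChar {d : ℕ} (m : Fin d → ℤ) : Continuous (intChar m) := by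
  unfold intChar
  fun_prop

lemma intChar_add_intVec {d : ℕ} (m k : Fin d → ℤ) (x : Fin d → ℝ) :
    intChar m (x + intVec k) = intChar m x := by
  rw [intChar, intChar, Complex.exp_eq_exp_iff_exists_int]
  refine ⟨∑ i, m i * k i, ?_⟩
  simp only [Pi.add_apply, intVec, mul_add, Finset.sum_add_distrib]
  push_cast
  ring

lemma mFourier_coe {d : ℕ} (m : Fin d → ℤ) (x : Fin d → ℝ) :
    UnitAddTorus.mFourier m (fun i => (x i : UnitAddCircle)) = intChar m x := by
  simp only [UnitAddTorus.mFourier, ContinuousMap.coe_mk, fourier_coe_apply, intChar]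
  rw [← Complex.exp_sum]
  congr 1
  push_cast
  rw [Finset.mul_sum]
  refine Finset.sum_congr rfl fun i _ => ?_
  simp
  ring

/-- **Poisson summation** on `ℝᵈ` for the lattice `ℤᵈ`. -/
theorem hasSum_poisson {d : ℕ} {g : (Fin d → ℝ) → ℂ} (hc : Continuous g) (hi : Integrable g)
    (hloc : ∀ R : ℝ, ∃ u : (Fin d → ℤ) → ℝ, Summable u ∧
      ∀ k x, ‖x‖ ≤ R → ‖g (x + intVec k)‖ ≤ u k)
    (hs : Summable fun m : Fin d → ℤ => ∫ x, intChar (-m) x * g x) (x : Fin d → ℝ) :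
    HasSum (fun m : Fin d → ℤ => (∫ x, intChar (-m) x * g x) * intChar m x)
      (∑' k : Fin d → ℤ, g (x + intVec k)) := by
  set P : (Fin d → ℝ) → ℂ := fun x => ∑' k : Fin d → ℤ, g (x + intVec k) with hP
  have hPc : Continuous P := by
    refine continuous_iff_continuousAt.mpr fun x => ?_
    obtain ⟨u, hu, hub⟩ := hloc (‖x‖ + 1)
    have hon : ContinuousOn P (Metric.ball 0 (‖x‖ + 1)) := by
      refine continuousOn_tsum (fun k => ?_) hu fun k y hy => hub k y ?_
      · exact (hc.comp (continuous_id.add continuous_const)).continuousOn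
      · exact (mem_ball_zero_iff.mp hy).le
    exact hon.continuousAt (Metric.isOpen_ball.mem_nhds (by simp))
  have hPper : ∀ (x : Fin d → ℝ) (l : Fin d → ℤ), P (x + intVec l) = P x := by
    intro x l
    simp only [hP]
    rw [← (Equiv.addLeft l).tsum_eq fun k => g (x + intVec k)]
    refine tsum_congr fun k => ?_
    congr 1
    ext i
    simp [intVec, add_assoc]
  let q : (Fin d → ℝ) → UnitAddTorus (Fin d) := Pi.map fun _ => QuotientAddGroup.mk
  have hq : IsOpenQuotientMap q :=
    IsOpenQuotientMap.piMap fun _ => QuotientAddGroup.isOpenQuotientMap_mk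
  have hlift : Function.FactorsThrough P q := by
    intro x y hxy
    have : ∀ i, ∃ k : ℤ, y i = x i + k := by
      intro i
      have hi : (x i : UnitAddCircle) = (y i : UnitAddCircle) := congrFun hxy i
      rw [QuotientAddGroup.eq, AddSubgroup.mem_zmultiples_iff] at hi
      obtain ⟨k, hk⟩ := hi
      refine ⟨k, ?_⟩
      simp at hk
      linarith
    choose k hk using this
    rw [show y = x + intVec k from funext hk, hPper]
  let F : C(UnitAddTorus (Fin d), ℂ) :=
    IsQuotientMap.lift (f := ⟨q, hq.continuous⟩) hq.isQuotientMap ⟨P, hPc⟩ hlift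
  have hF : ∀ x : Fin d → ℝ, F (fun i => (x i : UnitAddCircle)) = P x := fun x =>
    DFunLike.congr_fun (IsQuotientMap.lift_comp (f := ⟨q, hq.continuous⟩) hq.isQuotientMap
      ⟨P, hPc⟩ hlift) x
  have hcoeff : ∀ m : Fin d → ℤ,
      UnitAddTorus.mFourierCoeff F m = ∫ x, intChar (-m) x * g x := by
    intro m
    rw [UnitAddTorus.mFourierCoeff_eq_integral F m 0]
    obtain ⟨u, hu, hub⟩ := hloc 1
    rw [← integral_unitCube_tsum (h := fun x => intChar (-m) x * g x)
      ((continuous_intChar _).mul hc) (hi.bdd_mul (c := 1) (continuous_intChar (-m)).aestronglyMeasurable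
      (.of_forall fun x => (norm_intChar _ x).le)) hu ?_]
    · change ∫ x in unitCube 0, _ = _
      congr 1
      ext x
      rw [mFourier_coe, hF, smul_eq_mul, hP, ← tsum_mul_left]
      simp_rw [intChar_add_intVec]
    · intro k x hx
      rw [norm_mul, norm_intChar, one_mul]
      refine hub k x ((pi_norm_le_iff_of_nonneg zero_le_one).mpr fun i => ?_)
      have := hx i
      simp only [Pi.zero_apply, zero_add, mem_Ioc] at this
      rw [Real.norm_eq_abs, abs_le]
      constructor <;> linarith
  have hfin := UnitAddTorus.hasSum_mFourier_series_apply_of_summable (f := F)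
    (hs.congr fun m => (hcoeff m).symm) (fun i => (x i : UnitAddCircle))
  simpa only [hF, hcoeff, mFourier_coe, smul_eq_mul] using hfin

open Real in
/-- The Fourier transform of a Gaussian in linear coordinates `T`, at integral frequencies. -/
lemma exists_integral_intChar_gaussian {n : ℕ} (T : (Fin n → ℝ) ≃L[ℝ] Euc n)
    (W : (Fin n → ℤ) → Euc n) (hW : ∀ m x, ⟪W m, T x⟫ = ∑ i, (m i : ℝ) * x i)
    {s : ℝ} (hs : 0 < s) :
    Integrable (fun x => Complex.exp (-(π / s ^ 2 : ℝ) * ‖T x‖ ^ 2)) ∧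
    ∃ C : ℂ, C ≠ 0 ∧ ∀ m, ∫ x, intChar (-m) x * Complex.exp (-(π / s ^ 2 : ℝ) * ‖T x‖ ^ 2) =
      C * (Real.exp (-(π * s ^ 2) * ‖W m‖ ^ 2) : ℂ) := by
  have hb : 0 < ((π / s ^ 2 : ℝ) : ℂ).re := by
    rw [Complex.ofReal_re]; positivity
  have hT : MeasurableEmbedding T := T.toHomeomorph.measurableEmbedding
  have hhaar : (volume.map T).IsAddHaarMeasure := T.isAddHaarMeasure_map volume
  set c := Measure.addHaarScalarFactor (volume.map T) (volume : Measure (Euc n))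
  have hmap : volume.map T = c • (volume : Measure (Euc n)) :=
    Measure.isAddLeftInvariant_eq_smul _ _
  have hc0 : c ≠ 0 := (Measure.addHaarScalarFactor_pos_of_isAddHaarMeasure _ _).ne'
  constructor
  · have h := GaussianFourier.integrable_cexp_neg_mul_sq_norm_add hb 0 (0 : Euc n)
    have h2 : Integrable (fun v : Euc n => Complex.exp (-(π / s ^ 2 : ℝ) * ‖v‖ ^ 2))
        (volume.map T) := by
      rw [hmap]
      exact Integrable.smul_measure_nnreal (by simpa using h)
    exact (hT.integrable_map_iff).mp h2
  · refine ⟨(c : ℂ) * (π / (π / s ^ 2 : ℝ) : ℂ) ^ (Module.finrank ℝ (Euc n) / 2 : ℂ), ?_, ?_⟩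
    · refine mul_ne_zero (by exact_mod_cast hc0) ?_
      rw [Complex.cpow_ne_zero_iff]
      left
      rw [← Complex.ofReal_div]
      exact_mod_cast (by positivity : π / (π / s ^ 2) ≠ 0)
    intro m
    have key := fourier_gaussian_innerProductSpace hb (W m)
    rw [Real.fourier_eq'] at key
    have hcv : ∫ x, intChar (-m) x * Complex.exp (-(π / s ^ 2 : ℝ) * ‖T x‖ ^ 2) =
        ∫ v, Complex.exp (((-2 * π * ⟪v, W m⟫ : ℝ) : ℂ) * Complex.I) •
          Complex.exp (-(π / s ^ 2 : ℝ) * ‖v‖ ^ 2) ∂(volume.map T) := by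
      rw [hT.integral_map]
      congr 1
      ext x
      rw [smul_eq_mul, real_inner_comm, hW, intChar]
      congr 2
      push_cast
      simp only [Pi.neg_apply, Int.cast_neg, neg_mul, Finset.sum_neg_distrib]
      ring
    rw [hcv, hmap, integral_smul_nnreal_measure, key, NNReal.smul_def, Complex.real_smul, mul_assoc]
    congr 3
    push_cast
    congr 1
    have : (s : ℂ) ≠ 0 := by exact_mod_cast hs.ne'
    have : (π : ℂ) ≠ 0 := by exact_mod_cast pi_ne_zero
    field_simp

lemma sum_sq_le_mul_norm_map_sq {n : ℕ} (T : (Fin n → ℝ) ≃L[ℝ] Euc n) :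
    ∃ K > 0, ∀ k : Fin n → ℤ, ∑ i, (k i : ℝ) ^ 2 ≤ K * ‖T (intVec k)‖ ^ 2 := by
  refine ⟨n * ‖(T.symm : Euc n →L[ℝ] Fin n → ℝ)‖ ^ 2 + 1, by positivity, fun k => ?_⟩
  have h : ‖intVec k‖ ≤ ‖(T.symm : Euc n →L[ℝ] Fin n → ℝ)‖ * ‖T (intVec k)‖ := by
    simpa using (T.symm : Euc n →L[ℝ] Fin n → ℝ).le_opNorm (T (intVec k))
  have h2 : ∑ i, (k i : ℝ) ^ 2 ≤ ∑ _i : Fin n, ‖intVec k‖ ^ 2 := by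
    refine Finset.sum_le_sum fun i _ => ?_
    rw [← sq_abs]
    exact pow_le_pow_left₀ (abs_nonneg _) (norm_le_pi_norm (intVec k) i) 2
  rw [Finset.sum_const, Finset.card_univ, Fintype.card_fin, nsmul_eq_mul] at h2
  have h3 := mul_le_mul_of_nonneg_left (pow_le_pow_left₀ (norm_nonneg _) h 2) (Nat.cast_nonneg n)
  nlinarith [sq_nonneg ‖T (intVec k)‖]

lemma sum_sq_le_mul_norm_dual_sq {n : ℕ} (T : (Fin n → ℝ) ≃L[ℝ] Euc n)
    (W : (Fin n → ℤ) → Euc n) (hW : ∀ m x, ⟪W m, T x⟫ = ∑ i, (m i : ℝ) * x i) :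
    ∃ K > 0, ∀ k : Fin n → ℤ, ∑ i, (k i : ℝ) ^ 2 ≤ K * ‖W k‖ ^ 2 := by
  refine ⟨‖(T : (Fin n → ℝ) →L[ℝ] Euc n)‖ ^ 2 + 1, by positivity, fun k => ?_⟩
  set S := ∑ i, (k i : ℝ) ^ 2 with hS
  set a := ‖(T : (Fin n → ℝ) →L[ℝ] Euc n)‖
  have hS0 : 0 ≤ S := Finset.sum_nonneg fun i _ => sq_nonneg _
  have h1 : S ≤ ‖W k‖ * ‖T (intVec k)‖ := by
    have := real_inner_le_norm (W k) (T (intVec k))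
    rwa [hW, show ∑ i, (k i : ℝ) * intVec k i = S by simp [hS, intVec, sq]] at this
  have h2 : ‖T (intVec k)‖ ≤ a * ‖intVec k‖ :=
    (T : (Fin n → ℝ) →L[ℝ] Euc n).le_opNorm (intVec k)
  have h3 : ‖intVec k‖ ≤ √S := by
    refine (pi_norm_le_iff_of_nonneg (Real.sqrt_nonneg _)).mpr fun i => Real.abs_le_sqrt ?_
    exact Finset.single_le_sum (f := fun i => (k i : ℝ) ^ 2) (fun i _ => sq_nonneg _)
      (Finset.mem_univ i)
  have h4 : S ≤ ‖W k‖ * (a * √S) := h1.trans (by gcongr; exact h2.trans (by gcongr))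
  have h5 : √S ≤ ‖W k‖ * a := by
    rcases (Real.sqrt_nonneg S).eq_or_lt with h | h
    · rw [← h]; positivity
    · nlinarith [Real.sq_sqrt hS0]
  have h6 := pow_le_pow_left₀ (Real.sqrt_nonneg S) h5 2
  rw [Real.sq_sqrt hS0] at h6
  nlinarith [sq_nonneg ‖W k‖]

/-- The Gaussian mass of the shifted lattice `T ℤⁿ + t`. -/
def shiftMass {n : ℕ} (T : (Fin n → ℝ) ≃L[ℝ] Euc n) (s : ℝ) (t : Euc n) : ℝ :=
  ∑' k : Fin n → ℤ, Real.exp (-(Real.pi / s ^ 2) * ‖T (intVec k) + t‖ ^ 2)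

/-- The Gaussian mass of the nonzero vectors `W m`. -/
def nonzeroMass {n : ℕ} (W : (Fin n → ℤ) → Euc n) (s : ℝ) : ℝ :=
  ∑' m : {m : Fin n → ℤ // m ≠ 0}, Real.exp (-(Real.pi * s ^ 2) * ‖W m‖ ^ 2)

lemma exists_bound_exp_shift {n : ℕ} (T : (Fin n → ℝ) ≃L[ℝ] Euc n) {c : ℝ} (hc : 0 < c) (R : ℝ) :
    ∃ u : (Fin n → ℤ) → ℝ, Summable u ∧ ∀ k (t : Euc n), ‖t‖ ≤ R →
      Real.exp (-c * ‖T (intVec k) + t‖ ^ 2) ≤ u k := by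
  obtain ⟨K, hK, hT⟩ := sum_sq_le_mul_norm_map_sq T
  exact ⟨_, (summable_exp_neg_mul_norm_sq hK hT (half_pos hc)).mul_left (Real.exp (c * R ^ 2)),
    fun k t ht => exp_neg_mul_norm_add_sq_le hc.le ht _⟩

lemma summable_exp_shift {n : ℕ} (T : (Fin n → ℝ) ≃L[ℝ] Euc n) {c : ℝ} (hc : 0 < c) (t : Euc n) :
    Summable fun k : Fin n → ℤ => Real.exp (-c * ‖T (intVec k) + t‖ ^ 2) := by
  obtain ⟨u, hu, hb⟩ := exists_bound_exp_shift T hc ‖t‖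
  exact .of_nonneg_of_le (fun _ => (Real.exp_pos _).le) (fun k => hb k t le_rfl) hu

/-- All shifts of a lattice have nearly the same Gaussian mass, up to the mass of the nonzero
dual vectors. -/
theorem exists_shiftMass_near {n : ℕ} (T : (Fin n → ℝ) ≃L[ℝ] Euc n)
    (W : (Fin n → ℤ) → Euc n) (hW : ∀ m x, ⟪W m, T x⟫ = ∑ i, (m i : ℝ) * x i)
    {s : ℝ} (hs : 0 < s) :
    ∃ C > 0, ∀ t, C * (1 - nonzeroMass W s) ≤ shiftMass T s t ∧
      shiftMass T s t ≤ C * (1 + nonzeroMass W s) := by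
  obtain ⟨hint, C, hC, hcoeff⟩ := exists_integral_intChar_gaussian T W hW hs
  refine ⟨‖C‖, norm_pos_iff.mpr hC, fun t => ?_⟩
  obtain ⟨K, hK, hWK⟩ := sum_sq_le_mul_norm_dual_sq T W hW
  have hc : 0 < Real.pi / s ^ 2 := by have := Real.pi_pos; positivity
  have hd : 0 < Real.pi * s ^ 2 := by have := Real.pi_pos; positivity
  have hsW := summable_exp_neg_mul_norm_sq hK hWK hd
  have hexp : ∀ v : Euc n, Complex.exp (-(Real.pi / s ^ 2 : ℝ) * ‖v‖ ^ 2) =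
      (Real.exp (-(Real.pi / s ^ 2) * ‖v‖ ^ 2) : ℂ) := fun v => by push_cast; rfl
  have hP := hasSum_poisson (g := fun x => Complex.exp (-(Real.pi / s ^ 2 : ℝ) * ‖T x‖ ^ 2))
    (by fun_prop) hint ?_ ?_ (T.symm t)
  · have hval : ∑' k : Fin n → ℤ,
        Complex.exp (-(Real.pi / s ^ 2 : ℝ) * ‖T (T.symm t + intVec k)‖ ^ 2) =
        (shiftMass T s t : ℂ) := by
      rw [shiftMass, Complex.ofReal_tsum]
      refine tsum_congr fun k => ?_
      rw [hexp, map_add, T.apply_symm_apply, add_comm]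
    simp only [hcoeff] at hP
    rw [hval] at hP
    have hsplit := hP.summable.tsum_subtype_add_tsum_subtype_compl {0}
    rw [hP.tsum_eq, tsum_singleton (0 : Fin n → ℤ)
      (fun m => C * (Real.exp (-(Real.pi * s ^ 2) * ‖W m‖ ^ 2) : ℂ) * intChar m (T.symm t))]
      at hsplit
    have hW0 : W 0 = 0 := by
      have := hW 0 (T.symm (W 0))
      simpa using this
    have h0 : C * (Real.exp (-(Real.pi * s ^ 2) * ‖W 0‖ ^ 2) : ℂ) * intChar 0 (T.symm t) = C := by
      simp [hW0, intChar]
    rw [h0] at hsplit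
    set δ := ∑' m : ({0}ᶜ : Set (Fin n → ℤ)),
      C * (Real.exp (-(Real.pi * s ^ 2) * ‖W m‖ ^ 2) : ℂ) * intChar m (T.symm t)
    have hδle : ‖δ‖ ≤ ‖C‖ * nonzeroMass W s := by
      have hh : HasSum (fun m : ({0}ᶜ : Set (Fin n → ℤ)) =>
          ‖C‖ * Real.exp (-(Real.pi * s ^ 2) * ‖W m‖ ^ 2)) (‖C‖ * nonzeroMass W s) :=
        ((hsW.subtype ({0}ᶜ : Set (Fin n → ℤ))).hasSum).mul_left _
      refine tsum_of_norm_bounded hh fun m => ?_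
      rw [norm_mul, norm_mul, norm_intChar, mul_one, Complex.norm_real, Real.norm_eq_abs,
        Real.abs_exp]
    have hnn : 0 ≤ shiftMass T s t := tsum_nonneg fun _ => (Real.exp_pos _).le
    have hnorm : shiftMass T s t = ‖C + δ‖ := by
      rw [hsplit, Complex.norm_real, Real.norm_of_nonneg hnn]
    have h1 := norm_add_le C δ
    have h2 : ‖C‖ ≤ ‖C + δ‖ + ‖δ‖ := by simpa using norm_sub_le (C + δ) δ
    constructor <;> nlinarith
  · intro R
    obtain ⟨u, hu, hub⟩ := exists_bound_exp_shift T hc (‖(T : (Fin n → ℝ) →L[ℝ] Euc n)‖ * R)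
    refine ⟨u, hu, fun k x hx => ?_⟩
    rw [hexp, Complex.norm_real, Real.norm_eq_abs, Real.abs_exp, map_add, add_comm]
    refine hub k _ (((T : (Fin n → ℝ) →L[ℝ] Euc n).le_opNorm x).trans ?_)
    gcongr
  · simp only [hcoeff]
    exact (Complex.summable_ofReal.mpr hsW).mul_left C

lemma parallelogram_exp {n : ℕ} (s : ℝ) (x y : Euc n) :
    Real.exp (-(Real.pi / s ^ 2) * ‖x‖ ^ 2) * Real.exp (-(Real.pi / s ^ 2) * ‖y - x‖ ^ 2) =
      Real.exp (-(Real.pi / (√2 * s) ^ 2) * ‖y‖ ^ 2) *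
        Real.exp (-(Real.pi / (s / √2) ^ 2) * ‖x - (2⁻¹ : ℝ) • y‖ ^ 2) := by
  rw [← Real.exp_add, ← Real.exp_add, norm_sub_sq_real, norm_sub_sq_real, norm_smul,
    real_inner_smul_right, mul_pow, div_pow, Real.sq_sqrt zero_le_two, real_inner_comm]
  congr 1
  rcases eq_or_ne s 0 with rfl | hs
  · simp
  · norm_num
    field_simp
    ring

lemma tsum_exp_mul_exp_sub {n : ℕ} (T : (Fin n → ℝ) ≃L[ℝ] Euc n) (s : ℝ) (t y : Euc n) :
    ∑' k : Fin n → ℤ, Real.exp (-(Real.pi / s ^ 2) * ‖T (intVec k) + t‖ ^ 2) *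
        Real.exp (-(Real.pi / s ^ 2) * ‖y - (T (intVec k) + t)‖ ^ 2) =
      Real.exp (-(Real.pi / (√2 * s) ^ 2) * ‖y‖ ^ 2) *
        shiftMass T (s / √2) (t - (2⁻¹ : ℝ) • y) := by
  simp_rw [parallelogram_exp, shiftMass, tsum_mul_left, add_sub_assoc]

lemma hasSum_shiftMass_mul_shiftMass {n : ℕ} (T : (Fin n → ℝ) ≃L[ℝ] Euc n) {s : ℝ} (hs : 0 < s)
    (t1 t2 : Euc n) :
    HasSum (fun l : Fin n → ℤ =>
      Real.exp (-(Real.pi / (√2 * s) ^ 2) * ‖T (intVec l) + (t1 + t2)‖ ^ 2) *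
        shiftMass T (s / √2) (t1 - (2⁻¹ : ℝ) • (T (intVec l) + (t1 + t2))))
      (shiftMass T s t1 * shiftMass T s t2) := by
  have hc : 0 < Real.pi / s ^ 2 := by have := Real.pi_pos; positivity
  have h1 := summable_exp_shift T hc t1
  have h2 := summable_exp_shift T hc t2
  have h12 := h1.mul_of_nonneg h2 (fun _ => (Real.exp_pos _).le) (fun _ => (Real.exp_pos _).le)
  have hprod := h1.hasSum.mul h2.hasSum h12
  let e : (Fin n → ℤ) × (Fin n → ℤ) ≃ (Fin n → ℤ) × (Fin n → ℤ) :=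
    { toFun := fun p => (p.2, p.1 - p.2)
      invFun := fun p => (p.1 + p.2, p.1)
      left_inv := fun p => by simp
      right_inv := fun p => by simp }
  rw [← e.hasSum_iff] at hprod
  have := hprod.prod_fiberwise fun l => (hprod.summable.prod_factor l).hasSum
  refine this.congr_fun fun l => ?_
  rw [← tsum_exp_mul_exp_sub]
  refine tsum_congr fun k => ?_
  simp only [Function.comp_apply, e, Equiv.coe_fn_mk]
  congr 5
  have : intVec (l - k) = intVec l - intVec k := by ext i; simp [intVec]
  rw [this, map_sub]
  abel

lemma summable_nonzeroMass {n : ℕ} {W : (Fin n → ℤ) → Euc n} {K : ℝ} (hK : 0 < K)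
    (hW : ∀ k, ∑ i, (k i : ℝ) ^ 2 ≤ K * ‖W k‖ ^ 2) {s : ℝ} (hs : 0 < s) :
    Summable fun m : {m : Fin n → ℤ // m ≠ 0} =>
      Real.exp (-(Real.pi * s ^ 2) * ‖W m‖ ^ 2) :=
  (summable_exp_neg_mul_norm_sq hK hW
    (show 0 < Real.pi * s ^ 2 by have := Real.pi_pos; positivity)).subtype {m | m ≠ 0}

lemma dual_ne_zero {n : ℕ} {W : (Fin n → ℤ) → Euc n} {K : ℝ}
    (hW : ∀ k, ∑ i, (k i : ℝ) ^ 2 ≤ K * ‖W k‖ ^ 2) {m : Fin n → ℤ} (hm : m ≠ 0) : W m ≠ 0 := by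
  intro h
  have h1 := hW m
  rw [h, norm_zero, zero_pow two_ne_zero, mul_zero] at h1
  refine hm (funext fun i => ?_)
  have h2 := Finset.single_le_sum (f := fun i => (m i : ℝ) ^ 2) (fun i _ => sq_nonneg _)
    (Finset.mem_univ i)
  have h3 : (m i : ℝ) ^ 2 = 0 := le_antisymm (h2.trans h1) (sq_nonneg _)
  exact_mod_cast pow_eq_zero_iff two_ne_zero |>.mp h3

lemma tendsto_nonzeroMass {n : ℕ} {W : (Fin n → ℤ) → Euc n} {K : ℝ} (hK : 0 < K)
    (hW : ∀ k, ∑ i, (k i : ℝ) ^ 2 ≤ K * ‖W k‖ ^ 2) :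
    Filter.Tendsto (nonzeroMass W) Filter.atTop (𝓝 0) := by
  have h := tendsto_tsum_of_dominated_convergence (𝓕 := Filter.atTop)
    (f := fun (s : ℝ) (m : {m : Fin n → ℤ // m ≠ 0}) =>
      Real.exp (-(Real.pi * s ^ 2) * ‖W m‖ ^ 2)) (g := fun _ => 0)
    (summable_nonzeroMass hK hW one_pos) (fun m => ?_) ?_
  · rwa [tsum_zero] at h
  · refine Real.tendsto_exp_atBot.comp ?_
    have hpos : 0 < Real.pi * ‖W m‖ ^ 2 := by
      have := Real.pi_pos
      have := norm_pos_iff.mpr (dual_ne_zero hW m.2)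
      positivity
    have := (Filter.tendsto_pow_atTop (α := ℝ) two_ne_zero).const_mul_atTop hpos
    refine (Filter.tendsto_neg_atTop_atBot.comp this).congr fun s => ?_
    simp only [Function.comp_apply]
    ring
  · filter_upwards [Filter.eventually_ge_atTop 1] with s hs m
    rw [Real.norm_eq_abs, Real.abs_exp, Real.exp_le_exp, neg_mul, neg_mul, neg_le_neg_iff]
    have := Real.pi_pos
    gcongr

/-- The infimum defining the smoothing parameter is attained, and positive in positive
dimension. -/
lemma nonzeroMass_le_of_sInf_le {n : ℕ} {W : (Fin n → ℤ) → Euc n} {K : ℝ} (hK : 0 < K)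
    (hW : ∀ k, ∑ i, (k i : ℝ) ^ 2 ≤ K * ‖W k‖ ^ 2) (hn : n ≠ 0) {ε s : ℝ} (hε : 0 < ε)
    (hε1 : ε < 1) (hs : sInf {s : ℝ | 0 < s ∧ nonzeroMass W s ≤ ε} ≤ s) :
    0 < s ∧ nonzeroMass W s ≤ ε := by
  set S := {s : ℝ | 0 < s ∧ nonzeroMass W s ≤ ε}
  have hne : S.Nonempty :=
    (((tendsto_nonzeroMass hK hW).eventually_le_const hε).and
      (Filter.eventually_gt_atTop 0)).exists.imp fun s h => ⟨h.2, h.1⟩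
  have hpi := Real.pi_pos
  let m₀ : {m : Fin n → ℤ // m ≠ 0} := ⟨fun _ => 1, fun h => by
    simpa using congrFun h ⟨0, Nat.pos_of_ne_zero hn⟩⟩
  have hw := norm_pos_iff.mpr (dual_ne_zero hW m₀.2)
  have hlog : 0 < -Real.log ε := neg_pos.mpr (Real.log_neg hε hε1)
  have hlow : ∀ r ∈ S, √(-Real.log ε / (Real.pi * ‖W m₀‖ ^ 2)) ≤ r := by
    rintro r ⟨hr, hrε⟩
    refine Real.sqrt_le_iff.mpr ⟨hr.le, ?_⟩
    have h1 : Real.exp (-(Real.pi * r ^ 2) * ‖W m₀‖ ^ 2) ≤ ε :=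
      ((summable_nonzeroMass hK hW hr).le_tsum m₀ fun _ _ => (Real.exp_pos _).le).trans hrε
    have h2 := (Real.le_log_iff_exp_le hε).mpr h1
    rw [div_le_iff₀ (by positivity)]
    nlinarith
  have hspos : 0 < s :=
    (Real.sqrt_pos.mpr (by positivity)).trans_le ((le_csInf hne hlow).trans hs)
  refine ⟨hspos, Real.tsum_le_of_sum_le (fun _ => (Real.exp_pos _).le) fun F => ?_⟩
  have hcont : Continuous fun r : ℝ => ∑ m ∈ F, Real.exp (-(Real.pi * r ^ 2) * ‖W m‖ ^ 2) := by
    fun_prop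
  refine le_of_tendsto (hcont.continuousWithinAt (s := Ioi s) (x := s)) ?_
  filter_upwards [self_mem_nhdsWithin] with r hr
  obtain ⟨q, ⟨hq0, hqε⟩, hqr⟩ := exists_lt_of_csInf_lt hne (hs.trans_lt hr)
  refine le_trans ?_ (((summable_nonzeroMass hK hW hq0).sum_le_tsum F
    fun _ _ => (Real.exp_pos _).le).trans hqε)
  refine Finset.sum_le_sum fun m _ => ?_
  rw [Real.exp_le_exp, neg_mul, neg_mul, neg_le_neg_iff]
  gcongr

/-- Integral coordinates of the dual lattice: `dualVec T m` pairs with `T x` to `∑ i, m i * x i`. -/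
def dualVec {n : ℕ} (T : (Fin n → ℝ) ≃L[ℝ] Euc n) (m : Fin n → ℤ) : Euc n :=
  (InnerProductSpace.toDual ℝ (Euc n)).symm
    ((∑ i, (m i : ℝ) • ContinuousLinearMap.proj (R := ℝ) (φ := fun _ : Fin n => ℝ) i).comp
      (T.symm : Euc n →L[ℝ] Fin n → ℝ))

lemma inner_dualVec {n : ℕ} (T : (Fin n → ℝ) ≃L[ℝ] Euc n) (m : Fin n → ℤ) (x : Fin n → ℝ) :
    ⟪dualVec T m, T x⟫ = ∑ i, (m i : ℝ) * x i := by
  simp [dualVec, InnerProductSpace.toDual_symm_apply]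

lemma dualLattice_eq_range {n : ℕ} (T : (Fin n → ℝ) ≃L[ℝ] Euc n) :
    dualLattice (range fun k : Fin n → ℤ => T (intVec k)) = range (dualVec T) := by
  have hsingle : ∀ i, intVec (Pi.single i 1 : Fin n → ℤ) = Pi.single i (1 : ℝ) := by
    intro i
    ext j
    by_cases h : j = i
    · subst h; simp [intVec]
    · simp [intVec, h]
  ext v
  constructor
  · rintro ⟨-, hv⟩
    have := fun i => hv _ ⟨Pi.single i 1, rfl⟩
    choose m hm using this
    refine ⟨m, ext_inner_right ℝ fun z => ?_⟩
    obtain ⟨x, rfl⟩ := T.surjective z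
    rw [inner_dualVec]
    conv_rhs => rw [← Finset.univ_sum_single x, map_sum, inner_sum]
    refine Finset.sum_congr rfl fun i _ => ?_
    rw [← hm i]
    dsimp only
    rw [hsingle, show Pi.single i (x i) = x i • Pi.single i (1 : ℝ) by simp [← Pi.single_smul],
      map_smul, inner_smul_right, mul_comm]
  · rintro ⟨m, rfl⟩
    refine ⟨?_, ?_⟩
    · obtain ⟨x, hx⟩ := T.surjective (dualVec T m)
      rw [← hx, ← Finset.univ_sum_single x, map_sum]
      refine Submodule.sum_mem _ fun i _ => ?_
      rw [show Pi.single i (x i) = x i • Pi.single i (1 : ℝ) by simp [← Pi.single_smul], map_smul]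
      exact Submodule.smul_mem _ _ (Submodule.subset_span ⟨Pi.single i 1, by simp only [hsingle]⟩)
    · rintro _ ⟨k, rfl⟩
      refine ⟨∑ i, m i * k i, ?_⟩
      dsimp only
      rw [inner_dualVec]
      simp [intVec]

lemma dualVec_injective {n : ℕ} (T : (Fin n → ℝ) ≃L[ℝ] Euc n) :
    Function.Injective (dualVec T) := by
  intro m l h
  funext i
  have h1 := inner_dualVec T m (Pi.single i 1)
  rw [h, inner_dualVec] at h1
  simpa [Pi.single_apply] using h1.symm

lemma gaussianMass_dualLattice {n : ℕ} (T : (Fin n → ℝ) ≃L[ℝ] Euc n) (s : ℝ) :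
    gaussianMass (1 / s) (dualLattice (range fun k : Fin n → ℤ => T (intVec k)) \ {0}) =
      nonzeroMass (dualVec T) s := by
  have h0 : dualVec T 0 = 0 := by
    have := inner_dualVec T 0 (T.symm (dualVec T 0))
    simpa using this
  have hr : dualLattice (range fun k : Fin n → ℤ => T (intVec k)) \ {0} =
      range (dualVec T ∘ (Subtype.val : {m : Fin n → ℤ // m ≠ 0} → Fin n → ℤ)) := by
    rw [dualLattice_eq_range]
    ext v
    constructor
    · rintro ⟨⟨m, rfl⟩, hm⟩
      exact ⟨⟨m, fun h => hm (by simp [h, h0])⟩, rfl⟩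
    · rintro ⟨m, rfl⟩
      exact ⟨⟨m, rfl⟩, fun h => m.2 (dualVec_injective T (h.trans h0.symm))⟩
  rw [gaussianMass, hr, tsum_range (fun v : Euc n => Real.exp (-Real.pi * ‖v‖ ^ 2 / (1 / s) ^ 2))
    ((dualVec_injective T).comp Subtype.val_injective), nonzeroMass]
  refine tsum_congr fun m => ?_
  congr 1
  rw [one_div, inv_pow, div_inv_eq_mul, Function.comp_apply]
  ring

lemma tsum_shift_image {n : ℕ} (T : (Fin n → ℝ) ≃L[ℝ] Euc n) (t : Euc n) (f : Euc n → ℝ) :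
    ∑' x : ((fun v => v + t) '' range fun k : Fin n → ℤ => T (intVec k)), f x =
      ∑' k : Fin n → ℤ, f (T (intVec k) + t) := by
  have hinj : Function.Injective fun k : Fin n → ℤ => T (intVec k) + t := by
    intro k l h
    have h1 : intVec k = intVec l := T.injective (add_right_cancel h)
    exact funext fun i => by simpa [intVec] using congrFun h1 i
  rw [← range_comp]
  exact tsum_range f hinj

lemma neg_pi_mul_div (a s : ℝ) : -Real.pi * a / s ^ 2 = -(Real.pi / s ^ 2) * a := by ring

lemma gaussianMass_shift_image {n : ℕ} (T : (Fin n → ℝ) ≃L[ℝ] Euc n) (s : ℝ) (t : Euc n) :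
    gaussianMass s ((fun v => v + t) '' range fun k : Fin n → ℤ => T (intVec k)) =
      shiftMass T s t := by
  rw [gaussianMass, tsum_shift_image T t fun v => Real.exp (-Real.pi * ‖v‖ ^ 2 / s ^ 2)]
  simp_rw [neg_pi_mul_div, shiftMass]

lemma exists_coordinates {n : ℕ} (b : Fin n → Euc n) (hb : LinearIndependent ℝ b) :
    ∃ T : (Fin n → ℝ) ≃L[ℝ] Euc n,
      ((Submodule.span ℤ (range b) : Submodule ℤ (Euc n)) : Set (Euc n)) =
        range fun k : Fin n → ℤ => T (intVec k) := by
  let B : Module.Basis (Fin n) ℝ (Euc n) :=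
    basisOfLinearIndependentOfCardEqFinrank' b hb (by simp)
  refine ⟨B.equivFun.symm.toContinuousLinearEquiv, ?_⟩
  ext v
  rw [SetLike.mem_coe, Submodule.mem_span_range_iff_exists_fun]
  simp [B, intVec, Module.Basis.equivFun_symm_apply, Int.cast_smul_eq_zsmul]

lemma one_add_le_exp_mul_one_sub {ε : ℝ} (hε : 0 < ε) (hε3 : ε < 1 / 3) :
    1 + ε ≤ Real.exp (6 * ε) * (1 - ε) := by
  have h := Real.add_one_le_exp (6 * ε)
  nlinarith

/-- Weights `ρ l` tilted by a nearly constant factor `H` remain close to `ρ` after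
normalization. -/
lemma tilted_div_bounds {ι : Type*} {ρ H : ι → ℝ} {C ε D : ℝ} (hρ : ∀ l, 0 < ρ l)
    (hsum : Summable ρ) (hD : HasSum (fun l => ρ l * H l) D) (hC : 0 < C) (hε : 0 < ε)
    (hε3 : ε < 1 / 3) (hlo : ∀ l, C * (1 - ε) ≤ H l) (hhi : ∀ l, H l ≤ C * (1 + ε)) (l : ι) :
    Real.exp (-6 * ε) * (ρ l / ∑' j, ρ j) ≤ ρ l * H l / D ∧
      ρ l * H l / D ≤ Real.exp (6 * ε) * (ρ l / ∑' j, ρ j) := by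
  set R := ∑' j, ρ j
  have hRpos : 0 < R := hsum.tsum_pos (fun j => (hρ j).le) l (hρ l)
  have hDlo : R * (C * (1 - ε)) ≤ D :=
    hasSum_le (fun j => mul_le_mul_of_nonneg_left (hlo j) (hρ j).le) (hsum.hasSum.mul_right _) hD
  have hDhi : D ≤ R * (C * (1 + ε)) :=
    hasSum_le (fun j => mul_le_mul_of_nonneg_left (hhi j) (hρ j).le) hD (hsum.hasSum.mul_right _)
  have hDpos : 0 < D := lt_of_lt_of_le (mul_pos hRpos (mul_pos hC (by linarith))) hDlo
  have hexp := one_add_le_exp_mul_one_sub hε hε3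
  have hE := Real.exp_pos (6 * ε)
  have hl := hρ l
  rw [show -6 * ε = -(6 * ε) by ring, Real.exp_neg]
  have hCe : C * (1 + ε) ≤ Real.exp (6 * ε) * (C * (1 - ε)) := by nlinarith
  constructor
  · rw [← div_eq_inv_mul, div_div, div_le_div_iff₀ (by positivity) hDpos, mul_assoc]
    refine mul_le_mul_of_nonneg_left ?_ hl.le
    calc D ≤ R * (C * (1 + ε)) := hDhi
      _ ≤ R * (Real.exp (6 * ε) * (C * (1 - ε))) := by gcongr
      _ ≤ R * (Real.exp (6 * ε) * H l) := by gcongr; exact hlo l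
      _ = H l * (R * Real.exp (6 * ε)) := by ring
  · rw [← mul_div_assoc, div_le_div_iff₀ hDpos hRpos]
    calc ρ l * H l * R ≤ ρ l * (Real.exp (6 * ε) * (C * (1 - ε))) * R := by
          gcongr; exact (hhi l).trans hCe
      _ = Real.exp (6 * ε) * ρ l * (R * (C * (1 - ε))) := by ring
      _ ≤ Real.exp (6 * ε) * ρ l * D := by gcongr

theorem discrete_gaussian_convolution {n : ℕ} (b : Fin n → Euc n)
    (hb : LinearIndependent ℝ b)
    (L : Set (Euc n)) (hL : L = (Submodule.span ℤ (Set.range b) : Submodule ℤ (Euc n)))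
    (ε s : ℝ) (hε : 0 < ε) (hε3 : ε < 1/3)
    (hs : Real.sqrt 2 * eta ε L ≤ s)
    (t1 t2 : Euc n) (y : Euc n) (hy : y ∈ (fun v => v + (t1 + t2)) '' L) :
    Real.exp (-6 * ε) *
        (Real.exp (-Real.pi * ‖y‖ ^ 2 / (Real.sqrt 2 * s) ^ 2) /
          gaussianMass (Real.sqrt 2 * s) ((fun v => v + (t1 + t2)) '' L)) ≤
      (∑' x : ((fun v => v + t1) '' L),
          Real.exp (-Real.pi * ‖(x : Euc n)‖ ^ 2 / s ^ 2) *
            Real.exp (-Real.pi * ‖y - (x : Euc n)‖ ^ 2 / s ^ 2)) /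
        (gaussianMass s ((fun v => v + t1) '' L) * gaussianMass s ((fun v => v + t2) '' L)) ∧
    (∑' x : ((fun v => v + t1) '' L),
          Real.exp (-Real.pi * ‖(x : Euc n)‖ ^ 2 / s ^ 2) *
            Real.exp (-Real.pi * ‖y - (x : Euc n)‖ ^ 2 / s ^ 2)) /
        (gaussianMass s ((fun v => v + t1) '' L) * gaussianMass s ((fun v => v + t2) '' L)) ≤
      Real.exp (6 * ε) *
        (Real.exp (-Real.pi * ‖y‖ ^ 2 / (Real.sqrt 2 * s) ^ 2) /
          gaussianMass (Real.sqrt 2 * s) ((fun v => v + (t1 + t2)) '' L)) := by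
  obtain ⟨T, hT⟩ := exists_coordinates b hb
  obtain rfl : L = range fun k : Fin n → ℤ => T (intVec k) := hL.trans hT
  obtain ⟨_, ⟨l, rfl⟩, rfl⟩ := hy
  dsimp only
  set y := T (intVec l) + (t1 + t2) with hy
  rw [tsum_shift_image T t1 fun x => Real.exp (-Real.pi * ‖x‖ ^ 2 / s ^ 2) *
    Real.exp (-Real.pi * ‖y - x‖ ^ 2 / s ^ 2)]
  simp_rw [gaussianMass_shift_image, neg_pi_mul_div]
  rcases eq_or_ne n 0 with rfl | hn
  · have hzero : ∀ v : Euc 0, ‖v‖ = 0 := fun v => by rw [Subsingleton.elim v 0, norm_zero]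
    simp only [shiftMass, hzero]
    simp
    exact hε.le
  have hη : sInf {r : ℝ | 0 < r ∧ nonzeroMass (dualVec T) r ≤ ε} ≤ s / √2 := by
    rw [le_div_iff₀ (by positivity), mul_comm]
    simpa only [eta, gaussianMass_dualLattice] using hs
  obtain ⟨K, hK, hW⟩ := sum_sq_le_mul_norm_dual_sq T (dualVec T) (inner_dualVec T)
  obtain ⟨hspos', hmass⟩ := nonzeroMass_le_of_sInf_le hK hW hn hε (by linarith) hη
  have hspos : 0 < s := by
    have := mul_pos hspos' (show (0 : ℝ) < √2 by positivity)
    rwa [div_mul_cancel₀ _ (by positivity)] at this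
  obtain ⟨C, hC, hnear⟩ := exists_shiftMass_near T (dualVec T) (inner_dualVec T) hspos'
  have hpi := Real.pi_pos
  rw [tsum_exp_mul_exp_sub]
  exact tilted_div_bounds (fun _ => Real.exp_pos _)
    (summable_exp_shift T (by positivity) (t1 + t2))
    (hasSum_shiftMass_mul_shiftMass T hspos t1 t2) hC hε hε3
    (fun j => le_trans (by gcongr) (hnear _).1)
    (fun j => (hnear _).2.trans (by gcongr)) l
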